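/- arXiv:1905.04239 — 2 statements merged into one kernel-verified Lean document; each statement's English description precedes it below -/
import Mathlib

section
/- Let p ∈ [0,1], q = 1 − p, and let 0 < m < n be integers. Then the finite left absorption probability satisfies P_n^{(m)} = q^m (p^{n−m} − q^{n−m})/(p^n − q^n) if p ≠ q, and P_n^{(m)} = 1 − m/n if p = q = 1/2. -/
open scoped Classical
open Filter Topology

/-- The step value of a classical walk move: `true` ↦ +1, `false` ↦ −1. -/
def cstep (x : Bool) : ℤ := if x then 1 else -1

/-- Partial displacement `S_k(γ) = x_1 + ⋯ + x_k` of a `t`-path. -/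
def cS {t : ℕ} (γ : Fin t → Bool) (k : ℕ) : ℤ :=
  ∑ i ∈ Finset.univ.filter (fun i : Fin t => (i : ℕ) < k), cstep (γ i)

/-- Probability weight `P(γ) = p^{(t+S)/2} q^{(t−S)/2}` of a `t`-path. -/
noncomputable def cwt (p : ℝ) {t : ℕ} (γ : Fin t → Bool) : ℝ :=
  ∏ i : Fin t, (if γ i then p else 1 - p)

/-- Semi-infinite left absorption probability `P_∞^{(m)}`. -/
noncomputable def PinfC (p : ℝ) (m : ℕ) : ℝ :=
  ∑' t : ℕ, ∑ γ ∈ Finset.univ.filter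
      (fun γ : Fin t → Bool => cS γ t = -(m : ℤ) ∧ ∀ k < t, -(m : ℤ) < cS γ k),
    cwt p γ

/-- Finite left absorption probability `P_n^{(m)}` (absorbing boundaries at `0` and `n`). -/
noncomputable def PfinC (p : ℝ) (n m : ℕ) : ℝ :=
  ∑' t : ℕ, ∑ γ ∈ Finset.univ.filter
      (fun γ : Fin t → Bool => cS γ t = -(m : ℤ) ∧ (∀ k < t, -(m : ℤ) < cS γ k) ∧
        ∀ k ≤ t, cS γ k < (n : ℤ) - (m : ℤ)),
    cwt p γ

/-- The total weight of the paths of length exactly `t` contributing to `PfinC p n m`. -/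
noncomputable def absorbedWeight (p : ℝ) (n t m : ℕ) : ℝ :=
  ∑ γ ∈ Finset.univ.filter
      (fun γ : Fin t → Bool => cS γ t = -(m : ℤ) ∧ (∀ k < t, -(m : ℤ) < cS γ k) ∧
        ∀ k ≤ t, cS γ k < (n : ℤ) - (m : ℤ)),
    cwt p γ

lemma cS_zero {t : ℕ} (γ : Fin t → Bool) : cS γ 0 = 0 := by
  simp [cS]

lemma cS_cons_succ {t : ℕ} (x : Bool) (γ : Fin t → Bool) (k : ℕ) :
    cS (Fin.cons x γ : Fin (t + 1) → Bool) (k + 1) = cstep x + cS γ k := by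
  simp [cS, Finset.sum_filter, Fin.sum_univ_succ]

lemma cwt_cons (p : ℝ) {t : ℕ} (x : Bool) (γ : Fin t → Bool) :
    cwt p (Fin.cons x γ : Fin (t + 1) → Bool) = (if x then p else 1 - p) * cwt p γ := by
  simp [cwt, Fin.prod_univ_succ]

lemma cwt_nonneg {p : ℝ} (hp0 : 0 ≤ p) (hp1 : p ≤ 1) {t : ℕ} (γ : Fin t → Bool) :
    0 ≤ cwt p γ :=
  Finset.prod_nonneg fun i _ => by split_ifs <;> linarith

lemma absorbedWeight_nonneg {p : ℝ} (hp0 : 0 ≤ p) (hp1 : p ≤ 1) (n t m : ℕ) :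
    0 ≤ absorbedWeight p n t m :=
  Finset.sum_nonneg fun γ _ => cwt_nonneg hp0 hp1 γ

lemma absorbedWeight_length_zero (p : ℝ) (n : ℕ) {m : ℕ} (hm : 0 < m) :
    absorbedWeight p n 0 m = 0 := by
  refine Finset.sum_eq_zero fun γ hγ => ?_
  have := (Finset.mem_filter.1 hγ).2.1
  rw [cS_zero] at this
  omega

lemma absorbedWeight_left_zero (p : ℝ) {n : ℕ} (hn : 0 < n) :
    absorbedWeight p n 0 0 = 1 := by
  simp [absorbedWeight, cS, cwt, hn]

lemma absorbedWeight_left_succ (p : ℝ) (n t : ℕ) :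
    absorbedWeight p n (t + 1) 0 = 0 := by
  refine Finset.sum_eq_zero fun γ hγ => ?_
  have := (Finset.mem_filter.1 hγ).2.2.1 0 t.succ_pos
  simp [cS_zero] at this

lemma absorbedWeight_right (p : ℝ) (n t : ℕ) : absorbedWeight p n t n = 0 := by
  refine Finset.sum_eq_zero fun γ hγ => ?_
  have := (Finset.mem_filter.1 hγ).2.2.2 0 t.zero_le
  simp [cS_zero] at this

/-- Decomposition of the absorbed paths according to their first step. -/
lemma absorbedWeight_succ (p : ℝ) {n m : ℕ} (t : ℕ) (hmn : m + 1 < n) :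
    absorbedWeight p n (t + 1) (m + 1) =
      p * absorbedWeight p n t (m + 2) + (1 - p) * absorbedWeight p n t m := by
  have key (x : Bool) (m' : ℕ) (hx : (m' : ℤ) = m + 1 + cstep x) (γ : Fin t → Bool) :
      (cS (Fin.cons x γ : Fin (t + 1) → Bool) (t + 1) = -((m + 1 : ℕ) : ℤ) ∧
        (∀ k < t + 1, -((m + 1 : ℕ) : ℤ) < cS (Fin.cons x γ : Fin (t + 1) → Bool) k) ∧
        ∀ k ≤ t + 1, cS (Fin.cons x γ : Fin (t + 1) → Bool) k < (n : ℤ) - ((m + 1 : ℕ) : ℤ)) ↔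
      (cS γ t = -(m' : ℤ) ∧ (∀ k < t, -(m' : ℤ) < cS γ k) ∧
        ∀ k ≤ t, cS γ k < (n : ℤ) - (m' : ℤ)) := by
    rw [cS_cons_succ]
    refine and_congr (by push_cast; omega) (and_congr ?_ ?_)
    · constructor
      · intro h k hk
        have := h (k + 1) (by omega)
        rw [cS_cons_succ] at this
        push_cast at this
        omega
      · rintro h (_ | k) hk
        · rw [cS_zero]
          omega
        · have := h k (by omega)
          rw [cS_cons_succ]
          push_cast
          omega
    · constructor
      · intro h k hk
        have := h (k + 1) (by omega)
        rw [cS_cons_succ] at this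
        push_cast at this
        omega
      · rintro h (_ | k) hk
        · rw [cS_zero]
          omega
        · have := h k (by omega)
          rw [cS_cons_succ]
          push_cast
          omega
  unfold absorbedWeight
  simp only [Finset.sum_filter, Finset.mul_sum]
  rw [← (Fin.consEquiv fun _ : Fin (t + 1) => Bool).sum_comp, Fintype.sum_prod_type,
    Fintype.sum_bool]
  congr 1 <;> refine Finset.sum_congr rfl fun γ _ => ?_
  · simp only [Fin.consEquiv, Equiv.coe_fn_mk, cwt_cons, mul_ite, mul_zero]
    refine if_congr (key true (m + 2) ?_ γ) (by simp) rfl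
    simp [cstep]
    ring
  · simp only [Fin.consEquiv, Equiv.coe_fn_mk, cwt_cons, mul_ite, mul_zero]
    refine if_congr (key false m ?_ γ) (by simp) rfl
    simp [cstep]

/-- A positive function on `{0, …, n}` which a single step of the walk contracts strictly. -/
lemma exists_contracted_weight (p : ℝ) (n : ℕ) :
    ∃ (g : ℕ → ℝ) (r : ℝ), 0 ≤ r ∧ r < 1 ∧ (∀ m ≤ n, 1 ≤ g m) ∧
      ∀ m, m + 1 < n → p * g (m + 2) + (1 - p) * g m ≤ r * g (m + 1) := by
  obtain ⟨a, δ, ha, hδ, hδ1, hle, hstep⟩ : ∃ a δ : ℝ, 0 < a ∧ 0 < δ ∧ δ ≤ 1 ∧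
      (∀ m ≤ n, a ^ m ≤ 2 ^ n ∧ (1 / 2) ^ n ≤ a ^ m) ∧
      (1 + δ) * a ≤ p * a ^ 2 + (1 - p) := by
    have hle2 : ∀ m ≤ n, (2 : ℝ) ^ m ≤ 2 ^ n := fun m hm =>
      pow_le_pow_right₀ (by norm_num) hm
    have hle1 : ∀ m ≤ n, (1 / 2 : ℝ) ^ n ≤ (1 / 2) ^ m := fun m hm =>
      pow_le_pow_of_le_one (by norm_num) (by norm_num) hm
    have h2 (m : ℕ) : (1 : ℝ) ≤ 2 ^ m := one_le_pow₀ (by norm_num)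
    have h1 (m : ℕ) : (1 / 2 : ℝ) ^ m ≤ 1 := pow_le_one₀ (by norm_num) (by norm_num)
    rcases le_total (1 / 2) p with hp | hp
    · exact ⟨2, 1 / 4, by norm_num, by norm_num, by norm_num,
        fun m hm => ⟨hle2 m hm, (h1 n).trans (h2 m)⟩, by linarith⟩
    · exact ⟨1 / 2, 1 / 4, by norm_num, by norm_num, by norm_num,
        fun m hm => ⟨(h1 m).trans (h2 n), hle1 m hm⟩, by linarith⟩
  set K : ℝ := 2 ^ n + 1 with hK
  have hKpos : 1 ≤ K := by
    have : (0 : ℝ) < 2 ^ n := by positivity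
    linarith
  set c : ℝ := δ * (1 / 2) ^ n / K with hc
  have hcK : c * K = δ * (1 / 2) ^ n := div_mul_cancel₀ _ (by linarith)
  have hc0 : 0 < c := by positivity
  have hc1 : c ≤ 1 := by
    rw [hc, div_le_one (by linarith)]
    have : (1 / 2 : ℝ) ^ n ≤ 1 := pow_le_one₀ (by norm_num) (by norm_num)
    have : δ * (1 / 2 : ℝ) ^ n ≤ 1 := mul_le_one₀ hδ1 (by positivity) this
    linarith
  refine ⟨fun m => K - a ^ m, 1 - c, by linarith, by linarith, fun m hm => ?_, fun m hm => ?_⟩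
  · have := (hle m hm).1
    simp only
    linarith
  · have hpow : 0 < a ^ m := pow_pos ha m
    have hpow1 : 0 < a ^ (m + 1) := pow_pos ha _
    have hlow := mul_le_mul_of_nonneg_left (hle (m + 1) hm.le).2 hδ.le
    have hmain := mul_le_mul_of_nonneg_left hstep hpow.le
    have hcpow : 0 ≤ c * a ^ (m + 1) := by positivity
    simp only
    have e1 : a ^ (m + 1) = a ^ m * a := pow_succ a m
    have e2 : a ^ (m + 2) = a ^ m * a ^ 2 := pow_add a m 2
    rw [e2]
    rw [e1] at hlow hcpow ⊢
    linarith

/-- The absorption weights sum to the solution of the discrete Dirichlet problem with boundary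
values `1` at `0` and `0` at `n`. -/
lemma PfinC_eq_of_harmonic {p : ℝ} (hp0 : 0 ≤ p) (hp1 : p ≤ 1) {n : ℕ} (hn : 0 < n)
    (h : ℕ → ℝ) (h_left : h 0 = 1) (h_right : h n = 0)
    (h_step : ∀ m, m + 1 < n → h (m + 1) = p * h (m + 2) + (1 - p) * h m)
    {m : ℕ} (hm : m ≤ n) : PfinC p n m = h m := by
  obtain ⟨g, r, hr0, hr1, hg, hgstep⟩ := exists_contracted_weight p n
  set C : ℝ := ∑ k ∈ Finset.range (n + 1), |h k|
  have hC0 : 0 ≤ C := Finset.sum_nonneg fun _ _ => abs_nonneg _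
  have bound (N : ℕ) : ∀ k ≤ n,
      |h k - ∑ t ∈ Finset.range N, absorbedWeight p n t k| ≤ C * r ^ N * g k := by
    induction N with
    | zero =>
      intro k hk
      have : |h k| ≤ C := Finset.single_le_sum (f := fun k => |h k|)
        (fun _ _ => abs_nonneg _) (Finset.mem_range.2 (by omega))
      simpa using this.trans (le_mul_of_one_le_right hC0 (hg k hk))
    | succ N ih =>
      intro k hk
      have hrhs : 0 ≤ C * r ^ (N + 1) * g k :=
        mul_nonneg (by positivity) (zero_le_one.trans (hg k hk))
      rw [Finset.sum_range_succ']
      rcases k with _ | k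
      · simpa [absorbedWeight_left_succ, absorbedWeight_left_zero p hn, h_left] using hrhs
      rcases hk.eq_or_lt with rfl | hlt
      · simpa [absorbedWeight_right, h_right] using hrhs
      have e : h (k + 1) - (∑ t ∈ Finset.range N, absorbedWeight p n (t + 1) (k + 1) +
            absorbedWeight p n 0 (k + 1)) =
          p * (h (k + 2) - ∑ t ∈ Finset.range N, absorbedWeight p n t (k + 2)) +
          (1 - p) * (h k - ∑ t ∈ Finset.range N, absorbedWeight p n t k) := by
        simp only [absorbedWeight_succ p _ hlt, absorbedWeight_length_zero p n k.succ_pos,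
          Finset.sum_add_distrib, ← Finset.mul_sum, h_step k hlt]
        ring
      have hq : 0 ≤ 1 - p := by linarith
      calc
        _ ≤ p * |h (k + 2) - ∑ t ∈ Finset.range N, absorbedWeight p n t (k + 2)| +
            (1 - p) * |h k - ∑ t ∈ Finset.range N, absorbedWeight p n t k| := by
          rw [e]
          refine (abs_add_le _ _).trans_eq ?_
          rw [abs_mul, abs_mul, abs_of_nonneg hp0, abs_of_nonneg hq]
        _ ≤ p * (C * r ^ N * g (k + 2)) + (1 - p) * (C * r ^ N * g k) :=
          add_le_add (mul_le_mul_of_nonneg_left (ih _ (by omega)) hp0)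
            (mul_le_mul_of_nonneg_left (ih _ (by omega)) hq)
        _ = C * r ^ N * (p * g (k + 2) + (1 - p) * g k) := by ring
        _ ≤ C * r ^ N * (r * g (k + 1)) :=
          mul_le_mul_of_nonneg_left (hgstep k hlt) (by positivity)
        _ = C * r ^ (N + 1) * g (k + 1) := by ring
  have hlim : Tendsto (fun N : ℕ => C * r ^ N * g m) atTop (𝓝 0) := by
    simpa using ((tendsto_pow_atTop_nhds_zero_of_lt_one hr0 hr1).const_mul C).mul_const (g m)
  have hsum : HasSum (fun t => absorbedWeight p n t m) (h m) := by
    rw [hasSum_iff_tendsto_nat_of_nonneg fun t => absorbedWeight_nonneg hp0 hp1 n t m]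
    refine tendsto_iff_norm_sub_tendsto_zero.2 (squeeze_zero (fun _ => norm_nonneg _)
      (fun N => ?_) hlim)
    rw [Real.norm_eq_abs, abs_sub_comm]
    exact bound N m hm
  exact hsum.tsum_eq

theorem finite_classical_absorption (p : ℝ) (hp0 : 0 ≤ p) (hp1 : p ≤ 1)
    (m n : ℕ) (hm : 0 < m) (hmn : m < n) :
    (p ≠ 1 - p →
      PfinC p n m = (1 - p) ^ m * (p ^ (n - m) - (1 - p) ^ (n - m)) / (p ^ n - (1 - p) ^ n)) ∧
    (p = 1 / 2 → PfinC p n m = 1 - (m : ℝ) / (n : ℝ)) := by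
  have hn : 0 < n := hm.trans hmn
  constructor
  · intro hpq
    have hD : p ^ n - (1 - p) ^ n ≠ 0 := fun h0 =>
      hpq ((pow_left_inj₀ hp0 (by linarith) hn.ne').1 (sub_eq_zero.1 h0))
    refine PfinC_eq_of_harmonic hp0 hp1 hn
      (fun k => (1 - p) ^ k * (p ^ (n - k) - (1 - p) ^ (n - k)) / (p ^ n - (1 - p) ^ n))
      (by simp [hD]) (by simp) (fun k hk => ?_) hmn.le
    obtain ⟨b, rfl⟩ : ∃ b, n = k + 2 + b := Nat.exists_eq_add_of_le hk
    have e1 : k + 2 + b - (k + 1) = b + 1 := by omega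
    have e2 : k + 2 + b - (k + 2) = b := by omega
    have e3 : k + 2 + b - k = b + 2 := by omega
    simp only [e1, e2, e3]
    rw [mul_div_assoc', mul_div_assoc', ← add_div]
    congr 1
    ring
  · rintro rfl
    have hn' : (n : ℝ) ≠ 0 := by exact_mod_cast hn.ne'
    refine PfinC_eq_of_harmonic hp0 hp1 hn (fun k => 1 - (k : ℝ) / n)
      (by simp) (by simp [hn']) (fun k _ => ?_) hmn.le
    push_cast
    ring
end

section
/- The semi-infinite left absorption probability of the three-state Grover walk started at position 1 in internal state R satisfies P_∞^{(1)}(1,0,0) = 5√2/(2π) − 3·arcsin(1/3)/(4π) − 3/8. -/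
open scoped Classical
open Filter Topology

/-- Step value of a three-state internal state: `0` = R ↦ +1, `1` = S ↦ 0, `2` = L ↦ −1. -/
def gstep (σ : Fin 3) : ℤ := 1 - (σ : ℤ)

/-- Step amplitudes of the three-state Grover walk: `A(σ→σ) = −1/3`, `A(σ→σ') = 2/3` for σ ≠ σ'. -/
noncomputable def gamp (σ σ' : Fin 3) : ℝ := if σ = σ' then -1/3 else 2/3

/-- Amplitude `A(γ) = Π_{k=1}^t A(σ_{k−1}→σ_k)` of a `t`-path `γ = (σ_0, …, σ_t)`. -/
noncomputable def gpamp {t : ℕ} (γ : Fin (t + 1) → Fin 3) : ℝ :=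
  ∏ k : Fin t, gamp (γ k.castSucc) (γ k.succ)

/-- Partial displacement `S_k(γ) = σ_1 + ⋯ + σ_k` of a `t`-path `γ = (σ_0, …, σ_t)`. -/
def gS {t : ℕ} (γ : Fin (t + 1) → Fin 3) (k : ℕ) : ℤ :=
  ∑ i ∈ Finset.univ.filter (fun i : Fin t => (i : ℕ) < k), gstep (γ i.succ)

/-- `c_t` for the semi-infinite walk: sum of `A(γ)` over `t`-paths with `σ_0 = R`, `σ_t = L`,
`S_t(γ) = −m`, and `S_k(γ) > −m` for all `k < t`. -/
noncomputable def gcInf (m : ℕ) (t : ℕ) : ℝ :=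
  ∑ γ ∈ Finset.univ.filter (fun γ : Fin (t + 1) → Fin 3 =>
      γ 0 = 0 ∧ γ (Fin.last t) = 2 ∧ gS γ t = -(m : ℤ) ∧
      ∀ k < t, -(m : ℤ) < gS γ k),
    gpamp γ

/-- `c_t` for the finite walk: sum of `A(γ)` over `t`-paths with `σ_0 = R`, `σ_t = L`,
`S_t(γ) = −m`, and `−m < S_k(γ) < n − m` for all `k < t`. -/
noncomputable def gcFin (n m : ℕ) (t : ℕ) : ℝ :=
  ∑ γ ∈ Finset.univ.filter (fun γ : Fin (t + 1) → Fin 3 =>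
      γ 0 = 0 ∧ γ (Fin.last t) = 2 ∧ gS γ t = -(m : ℤ) ∧
      ∀ k < t, -(m : ℤ) < gS γ k ∧ gS γ k < (n : ℤ) - (m : ℤ)),
    gpamp γ

/-- Semi-infinite left absorption probability `P_∞^{(m)}(1,0,0)` of the Grover walk. -/
noncomputable def GPinf (m : ℕ) : ℝ := ∑' t : ℕ, (gcInf m t) ^ 2

/-- Finite left absorption probability `P_n^{(m)}(1,0,0)` of the Grover walk. -/
noncomputable def GPfin (n m : ℕ) : ℝ := ∑' t : ℕ, (gcFin n m t) ^ 2

/-- Taylor coefficients of `√(1 - x)`. -/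
noncomputable def sqrtCoeff : ℕ → ℝ
  | 0 => 1
  | n + 1 => sqrtCoeff n * (n - 1 / 2) / (n + 1)

lemma abs_sqrtCoeff_succ (n : ℕ) :
    |sqrtCoeff (n + 1)| = 2 * ((n + 1 : ℕ) : ℝ) * |sqrtCoeff (n + 1)|
      - 2 * ((n + 2 : ℕ) : ℝ) * |sqrtCoeff (n + 2)| := by
  have h : sqrtCoeff (n + 2) = sqrtCoeff (n + 1) * (((n + 1 : ℕ) : ℝ) - 1 / 2) /
      (((n + 1 : ℕ) : ℝ) + 1) := rfl
  have hn : (0 : ℝ) ≤ n := Nat.cast_nonneg n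
  rw [h, abs_div, abs_mul]
  push_cast
  rw [abs_of_nonneg (show (0 : ℝ) ≤ n + 1 - 1 / 2 by linarith),
    abs_of_nonneg (show (0 : ℝ) ≤ (n : ℝ) + 1 + 1 by linarith)]
  field_simp
  ring

lemma summable_abs_sqrtCoeff : Summable fun n => |sqrtCoeff n| := by
  rw [← summable_nat_add_iff 1]
  refine summable_of_sum_range_le (c := 1) (fun n => abs_nonneg _) fun n => ?_
  rw [Finset.sum_congr rfl fun i _ => abs_sqrtCoeff_succ i,
    Finset.sum_range_sub' (fun i : ℕ => 2 * ((i + 1 : ℕ) : ℝ) * |sqrtCoeff (i + 1)|) n]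
  have h0 : |sqrtCoeff (0 + 1)| = 1 / 2 := by
    norm_num [sqrtCoeff, abs_of_pos]
  rw [h0]
  have : 0 ≤ 2 * ((n + 1 : ℕ) : ℝ) * |sqrtCoeff (n + 1)| := by positivity
  norm_num at this ⊢
  exact this

/-- The power series of `√(1 - x)`. -/
noncomputable def sqrtSeries : PowerSeries ℂ := PowerSeries.mk fun n => (sqrtCoeff n : ℂ)

lemma sqrtSeries_deriv :
    (1 - PowerSeries.X) * PowerSeries.derivative ℂ sqrtSeries =
      PowerSeries.C (-1 / 2 : ℂ) * sqrtSeries := by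
  ext n
  rw [sub_mul, one_mul, map_sub, PowerSeries.coeff_C_mul, mul_comm PowerSeries.X]
  have key (n : ℕ) : (sqrtCoeff (n + 1) : ℂ) * (n + 1) = sqrtCoeff n * (n - 1 / 2) := by
    have hn : (n : ℂ) + 1 ≠ 0 := Nat.cast_add_one_ne_zero n
    rw [sqrtCoeff]
    push_cast
    field_simp
  cases n with
  | zero =>
    have := key 0
    simp [sqrtSeries, PowerSeries.coeff_derivative] at this ⊢
    rw [this]; ring
  | succ n =>
    have h1 := key (n + 1)
    have h0 := key n
    simp only [sqrtSeries, PowerSeries.coeff_succ_mul_X, PowerSeries.coeff_derivative,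
      PowerSeries.coeff_mk]
    rw [h1]; push_cast; ring

lemma sqrtSeries_mul_self : sqrtSeries * sqrtSeries = 1 - PowerSeries.X := by
  set Q := sqrtSeries * sqrtSeries with hQ
  have hd : (1 - PowerSeries.X) * PowerSeries.derivative ℂ Q = -Q := by
    rw [hQ, Derivation.leibniz, smul_eq_mul]
    have h2 : (PowerSeries.C (-1 / 2 : ℂ)) * 2 = -1 := by
      rw [show (2 : PowerSeries ℂ) = PowerSeries.C 2 from (map_ofNat _ 2).symm, ← map_mul]
      norm_num
    linear_combination (2 * sqrtSeries) * sqrtSeries_deriv + sqrtSeries * sqrtSeries * h2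
  have hc (n : ℕ) : PowerSeries.coeff (n + 1) Q * (n + 1) =
      PowerSeries.coeff n Q * (n - 1) := by
    have := congrArg (PowerSeries.coeff n) hd
    rw [sub_mul, one_mul, map_sub, mul_comm PowerSeries.X, map_neg] at this
    cases n with
    | zero => 
      simp [PowerSeries.coeff_derivative] at this ⊢
      rw [this]
    | succ n =>
      rw [PowerSeries.coeff_succ_mul_X, PowerSeries.coeff_derivative,
        PowerSeries.coeff_derivative] at this
      push_cast at this ⊢
      linear_combination this
  have h0 : PowerSeries.coeff 0 Q = 1 := by
    simp [hQ, sqrtSeries, sqrtCoeff]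
  have h1 : PowerSeries.coeff 1 Q = -1 := by
    have := hc 0
    rw [h0] at this
    simpa using this
  have h2 (n : ℕ) : PowerSeries.coeff (n + 2) Q = 0 := by
    induction n with
    | zero => 
      have := hc 1
      norm_num at this
      exact this
    | succ n ih =>
      have := hc (n + 2)
      rw [ih, zero_mul] at this
      refine (mul_eq_zero.1 this).resolve_right ?_
      exact Nat.cast_add_one_ne_zero (n + 2)
  ext n
  match n with
  | 0 => rw [h0]; simp
  | 1 => rw [h1]; simp [PowerSeries.coeff_one]
  | n + 2 => rw [h2]; simp [PowerSeries.coeff_X, PowerSeries.coeff_one]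

/-- A square root of `1 + 2x/3 + x²`. -/
noncomputable def discSeries : PowerSeries ℂ :=
  PowerSeries.rescale ((-1 + 2 * Real.sqrt 2 * Complex.I) / 3) sqrtSeries *
    PowerSeries.rescale ((-1 - 2 * Real.sqrt 2 * Complex.I) / 3) sqrtSeries

lemma discSeries_sq :
    9 * discSeries ^ 2 = 9 + 6 * PowerSeries.X + 9 * PowerSeries.X ^ 2 := by
  have h (a : ℂ) : PowerSeries.rescale a sqrtSeries * PowerSeries.rescale a sqrtSeries =
      1 - PowerSeries.C a * PowerSeries.X := by
    rw [← map_mul, sqrtSeries_mul_self, map_sub, map_one, PowerSeries.rescale_X]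
  have hs : (Real.sqrt 2 : ℂ) ^ 2 = 2 := by
    rw [← Complex.ofReal_pow, Real.sq_sqrt (by norm_num)]; norm_num
  set a : ℂ := (-1 + 2 * Real.sqrt 2 * Complex.I) / 3 with ha
  set b : ℂ := (-1 - 2 * Real.sqrt 2 * Complex.I) / 3 with hb
  have h1 : PowerSeries.C a * PowerSeries.C b = 1 := by
    rw [← map_mul, show a * b = 1 from ?_, map_one]
    linear_combination (-4 * Complex.I ^ 2 / 9) * hs - 8 / 9 * Complex.I_sq
  have h2 : 3 * (PowerSeries.C a + PowerSeries.C b) = -2 := by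
    rw [← map_add, show a + b = -2 / 3 by ring,
      show (3 : PowerSeries ℂ) = PowerSeries.C 3 from (map_ofNat _ 3).symm, ← map_mul,
      show (3 : ℂ) * (-2 / 3) = -2 by norm_num, map_neg, map_ofNat]
  rw [discSeries]
  have e : (PowerSeries.rescale a sqrtSeries * PowerSeries.rescale b sqrtSeries) ^ 2 =
    (1 - PowerSeries.C a * PowerSeries.X) * (1 - PowerSeries.C b * PowerSeries.X) := by
    rw [← h a, ← h b]; ring
  rw [e]
  linear_combination 9 * PowerSeries.X ^ 2 * h1 - 3 * PowerSeries.X * h2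

lemma constantCoeff_discSeries : PowerSeries.constantCoeff discSeries = 1 := by
  have h (a : ℂ) : PowerSeries.constantCoeff (PowerSeries.rescale a sqrtSeries) = 1 := by
    rw [← PowerSeries.coeff_zero_eq_constantCoeff_apply, PowerSeries.coeff_rescale]
    simp only [sqrtSeries, PowerSeries.coeff_mk, sqrtCoeff]
    norm_num
  rw [discSeries, map_mul, h, h, mul_one]

/-- Generating functions of the first passage amplitudes one level down from the states R, S, L. -/
lemma exists_passageSeries : ∃ F Y W : PowerSeries ℂ,
    4 * PowerSeries.X * F = 3 - 2 * PowerSeries.X + 3 * PowerSeries.X ^ 2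
      - 3 * (1 - PowerSeries.X) * discSeries ∧
    3 * F = PowerSeries.X * (2 + 2 * Y - F * W) ∧
    3 * Y = PowerSeries.X * (2 - Y + 2 * F * W) ∧
    3 * W = PowerSeries.X * (-1 + 2 * Y + 2 * F * W) := by
  have hX : (PowerSeries.X : PowerSeries ℂ) ≠ 0 := PowerSeries.X_ne_zero
  have two : (2 : PowerSeries ℂ) = PowerSeries.C 2 := (map_ofNat _ 2).symm
  have four : (4 : PowerSeries ℂ) = PowerSeries.C 4 := (map_ofNat _ 4).symm
  have dv (a : ℂ) (ha : a ≠ 0) (P : PowerSeries ℂ) (hP : PowerSeries.constantCoeff P = 0) :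
      ∃ Q, PowerSeries.C a * PowerSeries.X * Q = P := by
    obtain ⟨Q, rfl⟩ := PowerSeries.X_dvd_iff.2 hP
    refine ⟨PowerSeries.C a⁻¹ * Q, ?_⟩
    have : PowerSeries.C a * PowerSeries.C a⁻¹ = 1 := by
      rw [← map_mul, mul_inv_cancel₀ ha, map_one]
    linear_combination PowerSeries.X * Q * this
  obtain ⟨F, hF⟩ := dv 4 (by norm_num) (3 - 2 * PowerSeries.X + 3 * PowerSeries.X ^ 2
      - 3 * (1 - PowerSeries.X) * discSeries) (by simp [constantCoeff_discSeries])
  obtain ⟨Y, hY⟩ := dv 2 (by norm_num) (-(3 + PowerSeries.X) + 3 * discSeries)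
    (by simp [constantCoeff_discSeries])
  obtain ⟨W, hW⟩ := dv 2 (by norm_num) (-(3 + 4 * PowerSeries.X + 3 * PowerSeries.X ^ 2)
    + 3 * (1 + PowerSeries.X) * discSeries) (by simp [constantCoeff_discSeries])
  rw [← four] at hF
  rw [← two] at hY hW
  have hFW : 8 * PowerSeries.X ^ 2 * (F * W) =
     (3 - 2 * PowerSeries.X + 3 * PowerSeries.X ^ 2 - 3 * (1 - PowerSeries.X) * discSeries) *
     (-(3 + 4 * PowerSeries.X + 3 * PowerSeries.X ^ 2) + 3 * (1 + PowerSeries.X) * discSeries) := by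
    rw [← hF, ← hW]; ring
  have hD := discSeries_sq
  have c8 : (8 : PowerSeries ℂ) * PowerSeries.X ≠ 0 := by
    refine mul_ne_zero (fun h => ?_) hX
    rw [show (8 : PowerSeries ℂ) = PowerSeries.C 8 from (map_ofNat _ 8).symm,
      map_eq_zero_iff _ PowerSeries.C_injective] at h
    norm_num at h
  refine ⟨F, Y, W, hF, ?_, ?_, ?_⟩ <;> apply mul_left_cancel₀ c8
  · linear_combination 6 * hF - 8 * PowerSeries.X * hY + hFW - (1 - PowerSeries.X ^ 2) * hD
  · linear_combination 12 * hY + 4 * PowerSeries.X * hY - 2 * hFW + 2 * (1 - PowerSeries.X ^ 2) * hD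
  · linear_combination 12 * hW - 8 * PowerSeries.X * hY - 2 * hFW + 2 * (1 - PowerSeries.X ^ 2) * hD

lemma gS_cons_succ {t : ℕ} (σ : Fin 3) (γ : Fin (t + 1) → Fin 3) (k : ℕ) :
    gS (Fin.cons σ γ : Fin (t + 2) → Fin 3) (k + 1) = gstep (γ 0) + gS γ k := by
  simp only [gS, Finset.sum_filter]
  rw [Fin.sum_univ_succ]
  simp

lemma gS_zero {t : ℕ} (γ : Fin (t + 1) → Fin 3) : gS γ 0 = 0 := by
  simp [gS]

lemma gpamp_cons {t : ℕ} (σ : Fin 3) (γ : Fin (t + 1) → Fin 3) :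
    gpamp (Fin.cons σ γ : Fin (t + 2) → Fin 3) = gamp σ (γ 0) * gpamp γ := by
  simp only [gpamp]
  rw [Fin.prod_univ_succ]
  simp

/-- Sum of the amplitudes of the `t`-paths from `σ` that first reach level `-m` at time `t`. -/
noncomputable def passageAmp (t : ℕ) (σ : Fin 3) (m : ℤ) : ℝ :=
  ∑ γ : Fin (t + 1) → Fin 3, if γ 0 = σ ∧ γ (Fin.last t) = 2 ∧ gS γ t = -m ∧
      ∀ k < t, -m < gS γ k then gpamp γ else 0

lemma gcInf_eq_passageAmp (m t : ℕ) : gcInf m t = passageAmp t 0 m := by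
  rw [gcInf, passageAmp, Finset.sum_filter]

lemma passageAmp_zero (σ : Fin 3) {m : ℤ} (hm : 0 < m) : passageAmp 0 σ m = 0 := by
  refine Finset.sum_eq_zero fun γ _ => if_neg ?_
  rintro ⟨-, -, h, -⟩
  rw [gS_zero] at h
  omega

lemma passageAmp_zero_level (t : ℕ) : passageAmp t 2 0 = if t = 0 then 1 else 0 := by
  cases t with
  | zero =>
    rw [passageAmp, Fintype.sum_eq_single (fun _ => 2)]
    · simp [gS, gpamp]
    · intro γ hγ
      refine if_neg fun h => hγ ?_
      funext i
      rw [Fin.fin_one_eq_zero i, h.1]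
  | succ t =>
    refine Finset.sum_eq_zero fun γ _ => if_neg ?_
    rintro ⟨-, -, -, h⟩
    have := h 0 (Nat.succ_pos t)
    rw [gS_zero] at this
    omega

lemma passageAmp_succ (t : ℕ) (σ : Fin 3) {m : ℤ} (hm : 0 < m) :
    passageAmp (t + 1) σ m = ∑ τ : Fin 3, gamp σ τ * passageAmp t τ (m + gstep τ) := by
  simp only [passageAmp, Finset.mul_sum]
  rw [Finset.sum_comm, ← (Fin.consEquiv fun _ => Fin 3).sum_comp, Fintype.sum_prod_type,
    Finset.sum_comm]
  refine Finset.sum_congr rfl fun γ _ => ?_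
  rw [Fintype.sum_eq_single σ, Fintype.sum_eq_single (γ 0)]
  · have hlast : (Fin.cons σ γ : Fin (t + 2) → Fin 3) (Fin.last (t + 1)) = γ (Fin.last t) := by
      rw [← Fin.succ_last, Fin.cons_succ]
    have hk : (∀ k < t + 1, -m < gS (Fin.cons σ γ : Fin (t + 2) → Fin 3) k) ↔
        ∀ k < t, -(m + gstep (γ 0)) < gS γ k := by
      constructor
      · intro h k hk
        have := h (k + 1) (by omega)
        rw [gS_cons_succ] at this
        omega
      · intro h k hk
        cases k with
        | zero => rw [gS_zero]; omega
        | succ k =>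
          have := h k (by omega)
          rw [gS_cons_succ]
          omega
    have hS : gstep (γ 0) + gS γ t = -m ↔ gS γ t = -(m + gstep (γ 0)) := by omega
    have hc : (Fin.consEquiv fun _ => Fin 3) (σ, γ) = (Fin.cons σ γ : Fin (t + 2) → Fin 3) := rfl
    simp only [hc, Fin.cons_zero, hlast, hk, gS_cons_succ, hS, gpamp_cons,
      true_and, mul_ite, mul_zero]
  · intro τ hτ
    rw [if_neg (fun h => hτ h.1.symm), mul_zero]
  · intro τ hτ
    exact if_neg fun h => hτ h.1

lemma passageAmp_eq_coeff {F Y W : PowerSeries ℂ}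
    (hF : 3 * F = PowerSeries.X * (2 + 2 * Y - F * W))
    (hY : 3 * Y = PowerSeries.X * (2 - Y + 2 * F * W))
    (hW : 3 * W = PowerSeries.X * (-1 + 2 * Y + 2 * F * W)) (t h : ℕ) (σ : Fin 3) :
    (passageAmp t σ (h + 1) : ℂ) = PowerSeries.coeff t (![F, Y, W] σ * W ^ h) := by
  have c3 (n : ℕ) (P : PowerSeries ℂ) :
      PowerSeries.coeff n (3 * P) = 3 * PowerSeries.coeff n P := by
    rw [show (3 : PowerSeries ℂ) = PowerSeries.C 3 from (map_ofNat _ 3).symm,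
      PowerSeries.coeff_C_mul]
  have c2 (n : ℕ) (P : PowerSeries ℂ) :
      PowerSeries.coeff n (2 * P) = 2 * PowerSeries.coeff n P := by
    rw [show (2 : PowerSeries ℂ) = PowerSeries.C 2 from (map_ofNat _ 2).symm,
      PowerSeries.coeff_C_mul]
  have hFh : 3 * (F * W ^ h) = PowerSeries.X * (2 * W ^ h + 2 * (Y * W ^ h) - F * W ^ (h + 1)) := by
    linear_combination W ^ h * hF
  have hYh : 3 * (Y * W ^ h) =
      PowerSeries.X * (2 * W ^ h - Y * W ^ h + 2 * (F * W ^ (h + 1))) := by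
    linear_combination W ^ h * hY
  have hWh : 3 * (W * W ^ h) =
      PowerSeries.X * (2 * (Y * W ^ h) - W ^ h + 2 * (F * W ^ (h + 1))) := by
    linear_combination W ^ h * hW
  induction t generalizing h σ with
  | zero =>
    rw [passageAmp_zero σ (by omega)]
    have hFh := congrArg (PowerSeries.coeff 0) hFh
    have hYh := congrArg (PowerSeries.coeff 0) hYh
    have hWh := congrArg (PowerSeries.coeff 0) hWh
    rw [c3, PowerSeries.coeff_zero_X_mul] at hFh hYh hWh
    fin_cases σ
    · simpa using hFh.symm
    · simpa using hYh.symm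
    · simpa using hWh.symm
  | succ t ih =>
    have hFhs := congrArg (PowerSeries.coeff (t + 1)) hFh
    have hYhs := congrArg (PowerSeries.coeff (t + 1)) hYh
    have hWhs := congrArg (PowerSeries.coeff (t + 1)) hWh
    rw [c3, PowerSeries.coeff_succ_X_mul, map_add, map_sub] at hYhs hWhs
    rw [c3, PowerSeries.coeff_succ_X_mul, map_sub, map_add] at hFhs
    simp only [c2] at hFhs hYhs hWhs
    have up : (passageAmp t 0 (h + 1 + 1) : ℂ) = PowerSeries.coeff t (F * W ^ (h + 1)) := by
      have := ih (h + 1) 0 (by linear_combination W ^ (h + 1) * hF)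
        (by linear_combination W ^ (h + 1) * hY) (by linear_combination W ^ (h + 1) * hW)
      simpa using this
    have stay : (passageAmp t 1 (h + 1) : ℂ) = PowerSeries.coeff t (Y * W ^ h) := by
      simpa using ih h 1 hFh hYh hWh
    have down : (passageAmp t 2 h : ℂ) = PowerSeries.coeff t (W ^ h) := by
      cases h with
      | zero =>
        rw [pow_zero, PowerSeries.coeff_one, Nat.cast_zero, passageAmp_zero_level]
        split_ifs <;> simp
      | succ h =>
        have := ih h 2 (by linear_combination W ^ h * hF)
          (by linear_combination W ^ h * hY) (by linear_combination W ^ h * hW)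
        rw [pow_succ']
        simpa using this
    rw [passageAmp_succ t σ (by omega), Fin.sum_univ_three]
    have s0 : ((h : ℤ) + 1 + gstep 0) = h + 1 + 1 := by simp [gstep]
    have s1 : ((h : ℤ) + 1 + gstep 1) = h + 1 := by simp [gstep]
    have s2 : ((h : ℤ) + 1 + gstep 2) = h := by simp [gstep]
    rw [s0, s1, s2]
    push_cast
    rw [up, stay, down]
    fin_cases σ
    · simp [gamp]
      linear_combination (-1 / 3 : ℂ) * hFhs
    · simp [gamp]
      linear_combination (-1 / 3 : ℂ) * hYhs
    · simp [gamp]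
      linear_combination (-1 / 3 : ℂ) * hWhs

/-- Absolute summability of the coefficients of a power series. -/
def AbsSummable (P : PowerSeries ℂ) : Prop := Summable fun n => ‖PowerSeries.coeff n P‖

/-- Value of a power series at a point. -/
noncomputable def psEval (z : ℂ) (P : PowerSeries ℂ) : ℂ := ∑' n, PowerSeries.coeff n P * z ^ n

lemma AbsSummable.norm_mul_pow {P : PowerSeries ℂ} (hP : AbsSummable P) {z : ℂ} (hz : ‖z‖ ≤ 1) :
    Summable fun n => ‖PowerSeries.coeff n P * z ^ n‖ := by
  refine Summable.of_nonneg_of_le (fun _ => norm_nonneg _) (fun n => ?_) hP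
  rw [norm_mul, norm_pow]
  exact mul_le_of_le_one_right (norm_nonneg _) (pow_le_one₀ (norm_nonneg _) hz)

lemma AbsSummable.add {P Q : PowerSeries ℂ} (hP : AbsSummable P) (hQ : AbsSummable Q) :
    AbsSummable (P + Q) := by
  refine Summable.of_nonneg_of_le (fun _ => norm_nonneg _) (fun n => ?_) (Summable.add hP hQ)
  rw [map_add]
  exact norm_add_le _ _

lemma AbsSummable.mul {P Q : PowerSeries ℂ} (hP : AbsSummable P) (hQ : AbsSummable Q) :
    AbsSummable (P * Q) := by
  refine (summable_norm_sum_mul_antidiagonal_of_summable_norm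
    (f := fun n => PowerSeries.coeff n P) (g := fun n => PowerSeries.coeff n Q) hP hQ).congr
    fun n => ?_
  rw [PowerSeries.coeff_mul]

lemma absSummable_C (a : ℂ) : AbsSummable (PowerSeries.C a) := by
  refine summable_of_ne_finset_zero (s := {0}) fun n hn => ?_
  rw [PowerSeries.coeff_C, if_neg (by simpa using hn), norm_zero]

lemma absSummable_X : AbsSummable PowerSeries.X := by
  refine summable_of_ne_finset_zero (s := {1}) fun n hn => ?_
  rw [PowerSeries.coeff_X, if_neg (by simpa using hn), norm_zero]

lemma AbsSummable.of_X_mul {P : PowerSeries ℂ} (h : AbsSummable (PowerSeries.X * P)) :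
    AbsSummable P := by
  have := (summable_nat_add_iff 1).2 h
  simpa only [AbsSummable, PowerSeries.coeff_succ_X_mul] using this

lemma psEval_add {z : ℂ} (hz : ‖z‖ ≤ 1) {P Q : PowerSeries ℂ} (hP : AbsSummable P)
    (hQ : AbsSummable Q) : psEval z (P + Q) = psEval z P + psEval z Q := by
  simp only [psEval, map_add, add_mul]
  exact (hP.norm_mul_pow hz).of_norm.tsum_add (hQ.norm_mul_pow hz).of_norm

lemma psEval_mul {z : ℂ} (hz : ‖z‖ ≤ 1) {P Q : PowerSeries ℂ} (hP : AbsSummable P)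
    (hQ : AbsSummable Q) : psEval z (P * Q) = psEval z P * psEval z Q := by
  simp only [psEval]
  rw [tsum_mul_tsum_eq_tsum_sum_antidiagonal_of_summable_norm (hP.norm_mul_pow hz)
    (hQ.norm_mul_pow hz)]
  refine tsum_congr fun n => ?_
  rw [PowerSeries.coeff_mul, Finset.sum_mul]
  refine Finset.sum_congr rfl fun p hp => ?_
  rw [← Finset.HasAntidiagonal.mem_antidiagonal.1 hp, pow_add]
  ring

lemma psEval_C (z a : ℂ) : psEval z (PowerSeries.C a) = a := by
  rw [psEval, tsum_eq_single 0 fun n hn => by rw [PowerSeries.coeff_C, if_neg hn, zero_mul]]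
  simp

lemma psEval_X (z : ℂ) : psEval z PowerSeries.X = z := by
  rw [psEval, tsum_eq_single 1 fun n hn => by rw [PowerSeries.coeff_X, if_neg hn, zero_mul]]
  simp

lemma continuousOn_psEval {P : PowerSeries ℂ} (hP : AbsSummable P) :
    ContinuousOn (fun z => psEval z P) (Metric.closedBall 0 1) := by
  refine continuousOn_tsum (fun n => by fun_prop) hP fun n z hz => ?_
  rw [norm_mul, norm_pow]
  exact mul_le_of_le_one_right (norm_nonneg _)
    (pow_le_one₀ (norm_nonneg _) (mem_closedBall_zero_iff.1 hz))

lemma absSummable_rescale {a : ℂ} (ha : ‖a‖ ≤ 1) {P : PowerSeries ℂ} (hP : AbsSummable P) :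
    AbsSummable (PowerSeries.rescale a P) := by
  have := hP.norm_mul_pow ha
  simpa only [AbsSummable, PowerSeries.coeff_rescale, mul_comm] using this

lemma absSummable_discSeries : AbsSummable discSeries := by
  have h : AbsSummable sqrtSeries := by
    simpa [AbsSummable, sqrtSeries] using summable_abs_sqrtCoeff
  have hs : (Real.sqrt 2) ^ 2 = 2 := Real.sq_sqrt (by norm_num)
  refine (absSummable_rescale ?_ h).mul (absSummable_rescale ?_ h)
  all_goals
    rw [← sq_le_one_iff₀ (norm_nonneg _), ← Complex.normSq_eq_norm_sq, Complex.normSq_apply]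
    simp
    nlinarith [hs]

open Complex in
/-- Parseval's identity for absolutely convergent power series on the unit circle. -/
lemma tsum_normSq_coeff {P : PowerSeries ℂ} (hP : AbsSummable P) :
    ∑' n, ‖PowerSeries.coeff n P‖ ^ 2 =
      (∫ θ in (0 : ℝ)..2 * Real.pi, ‖psEval (exp (θ * I)) P‖ ^ 2) / (2 * Real.pi) := by
  set c : ℕ → ℂ := fun n => PowerSeries.coeff n P with hc
  have hnorm (θ : ℝ) : ‖exp (θ * I)‖ = 1 := norm_exp_ofReal_mul_I θ
  have horth (n m : ℕ) : ∫ θ in (0 : ℝ)..2 * Real.pi,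
      exp (θ * I) ^ n * (starRingEnd ℂ) (exp (θ * I) ^ m) = if n = m then 2 * Real.pi else 0 := by
    have e (θ : ℝ) : exp (θ * I) ^ n * (starRingEnd ℂ) (exp (θ * I) ^ m) =
        exp (((n - m : ℤ) * I : ℂ) * θ) := by
      rw [map_pow, ← exp_conj, ← exp_nat_mul, ← exp_nat_mul, ← exp_add]
      simp
      ring_nf
    simp only [e]
    split_ifs with h
    · subst h; simp
    · have hne : (((n - m : ℤ) : ℂ) * I) ≠ 0 := by
        refine mul_ne_zero ?_ I_ne_zero
        rw [Ne, Int.cast_eq_zero]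
        omega
      rw [integral_exp_mul_complex hne]
      have : (((n - m : ℤ) : ℂ) * I) * ((2 * Real.pi : ℝ) : ℂ) =
          ((n - m : ℤ) : ℂ) * (2 * Real.pi * I) := by push_cast; ring
      rw [this, exp_int_mul_two_pi_mul_I]
      simp
  have hcont : Continuous fun θ : ℝ => psEval (exp (θ * I)) P :=
    (continuousOn_psEval hP).comp_continuous (by fun_prop) fun θ => by
      simp [hnorm]
  have swap (g : ℝ → ℂ) (hg : Continuous g) (C : ℝ) (hC : ∀ θ, ‖g θ‖ ≤ C) :
      HasSum (fun n => ∫ θ in (0 : ℝ)..2 * Real.pi, c n * (exp (θ * I) ^ n * g θ))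
        (∫ θ in (0 : ℝ)..2 * Real.pi, psEval (exp (θ * I)) P * g θ) := by
    refine intervalIntegral.hasSum_integral_of_dominated_convergence
      (fun n _ => ‖c n‖ * C) (fun n => ?_) (fun n => ?_) ?_ ?_ ?_
    · exact (by fun_prop : Continuous fun θ : ℝ => c n * (exp (θ * I) ^ n * g θ)).aestronglyMeasurable
    · refine Filter.Eventually.of_forall fun θ _ => ?_
      rw [norm_mul, norm_mul, norm_pow, hnorm, one_pow, one_mul]
      exact mul_le_mul_of_nonneg_left (hC θ) (norm_nonneg _)
    · exact Filter.Eventually.of_forall fun θ _ => Summable.mul_right C hP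
    · exact intervalIntegrable_const
    · refine Filter.Eventually.of_forall fun θ _ => ?_
      have := ((hP.norm_mul_pow (hnorm θ).le).of_norm.hasSum).mul_right (g θ)
      simpa only [mul_assoc, psEval] using this
  have inner (m : ℕ) : ∫ θ in (0 : ℝ)..2 * Real.pi,
      psEval (exp (θ * I)) P * (starRingEnd ℂ) (exp (θ * I) ^ m) = c m * (2 * Real.pi) := by
    have := swap (fun θ => (starRingEnd ℂ) (exp (θ * I) ^ m)) (by fun_prop) 1 fun θ => by
      rw [RCLike.norm_conj, norm_pow, hnorm, one_pow]
    simp only [intervalIntegral.integral_const_mul, horth] at this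
    refine this.unique ?_
    have h2 := hasSum_ite_eq m (c m * (2 * Real.pi))
    convert h2 using 2 with n
    split_ifs with h
    · rw [h]; push_cast; rfl
    · simp
  have outer := swap (fun θ => (starRingEnd ℂ) (psEval (exp (θ * I)) P))
    (by fun_prop) (∑' n, ‖c n‖) fun θ => by
      rw [RCLike.norm_conj, psEval]
      refine (norm_tsum_le_tsum_norm (hP.norm_mul_pow (hnorm θ).le)).trans_eq ?_
      simp [norm_pow, hnorm, hc]
  have term (n : ℕ) : ∫ θ in (0 : ℝ)..2 * Real.pi,
      c n * (exp (θ * I) ^ n * (starRingEnd ℂ) (psEval (exp (θ * I)) P)) =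
      ((‖c n‖ ^ 2 * (2 * Real.pi) : ℝ) : ℂ) := by
    rw [intervalIntegral.integral_const_mul]
    have h1 (θ : ℝ) : exp (θ * I) ^ n * (starRingEnd ℂ) (psEval (exp (θ * I)) P) =
        (starRingEnd ℂ) (psEval (exp (θ * I)) P * (starRingEnd ℂ) (exp (θ * I) ^ n)) := by
      rw [map_mul, Complex.conj_conj, mul_comm]
    simp only [h1]
    rw [intervalIntegral.intervalIntegral_conj, inner, map_mul, ← mul_assoc, Complex.mul_conj,
      Complex.normSq_eq_norm_sq]
    simp [Complex.conj_ofReal, map_ofNat]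
  simp only [term] at outer
  have e2 : (∫ θ in (0 : ℝ)..2 * Real.pi,
      psEval (exp (θ * I)) P * (starRingEnd ℂ) (psEval (exp (θ * I)) P)) =
      ((∫ θ in (0 : ℝ)..2 * Real.pi, ‖psEval (exp (θ * I)) P‖ ^ 2 : ℝ) : ℂ) := by
    rw [← intervalIntegral.integral_ofReal]
    refine intervalIntegral.integral_congr fun θ _ => ?_
    simp only [Complex.mul_conj, Complex.normSq_eq_norm_sq]
  rw [e2] at outer
  have := (Complex.hasSum_ofReal.1 outer).tsum_eq
  rw [tsum_mul_right] at this
  rw [← this, mul_div_cancel_right₀ _ (by positivity)]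

lemma psC_two : (PowerSeries.C 2 : PowerSeries ℂ) = 2 := map_ofNat _ 2

lemma psC_three : (PowerSeries.C 3 : PowerSeries ℂ) = 3 := map_ofNat _ 3

lemma psC_four : (PowerSeries.C 4 : PowerSeries ℂ) = 4 := map_ofNat _ 4

lemma absSummable_passage {F : PowerSeries ℂ}
    (hF : 4 * PowerSeries.X * F = 3 - 2 * PowerSeries.X + 3 * PowerSeries.X ^ 2
      - 3 * (1 - PowerSeries.X) * discSeries) : AbsSummable F := by
  have h1 : PowerSeries.X * (PowerSeries.C 4 * F) = (PowerSeries.C 3 +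
      PowerSeries.C (-2) * PowerSeries.X + PowerSeries.C 3 * (PowerSeries.X * PowerSeries.X)) +
      (PowerSeries.C (-3) + PowerSeries.C 3 * PowerSeries.X) * discSeries := by
    simp only [map_neg, psC_two, psC_three, psC_four]
    linear_combination hF
  have hX := absSummable_X
  have h2 : AbsSummable (PowerSeries.X * (PowerSeries.C 4 * F)) := by
    rw [h1]
    exact (((absSummable_C _).add ((absSummable_C _).mul hX)).add
      ((absSummable_C _).mul (hX.mul hX))).add
      (((absSummable_C _).add ((absSummable_C _).mul hX)).mul absSummable_discSeries)
  have h3 := (absSummable_C (1 / 4)).mul h2.of_X_mul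
  rwa [← mul_assoc, ← map_mul, one_div_mul_cancel (by norm_num), map_one, one_mul] at h3

lemma psEval_passage_quadratic {F : PowerSeries ℂ}
    (hF : 4 * PowerSeries.X * F = 3 - 2 * PowerSeries.X + 3 * PowerSeries.X ^ 2
      - 3 * (1 - PowerSeries.X) * discSeries)
    {z : ℂ} (hz : ‖z‖ ≤ 1) :
    2 * z * (psEval z F ^ 2 + 1) = (3 - 2 * z + 3 * z ^ 2) * psEval z F := by
  have hX := absSummable_X
  have hFs := absSummable_passage hF
  have hq : PowerSeries.C 2 * PowerSeries.X * (F * F + PowerSeries.C 1) =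
      (PowerSeries.C 3 + PowerSeries.C (-2) * PowerSeries.X +
        PowerSeries.C 3 * (PowerSeries.X * PowerSeries.X)) * F := by
    have c8 : PowerSeries.C (8 : ℂ) * PowerSeries.X ≠ 0 := by
      refine mul_ne_zero (fun h => ?_) PowerSeries.X_ne_zero
      rw [map_eq_zero_iff _ PowerSeries.C_injective] at h
      norm_num at h
    apply mul_left_cancel₀ c8
    rw [show (PowerSeries.C 8 : PowerSeries ℂ) = 8 from map_ofNat _ 8]
    simp only [map_neg, map_one, psC_two, psC_three]
    linear_combination (4 * PowerSeries.X * F - (3 - 2 * PowerSeries.X + 3 * PowerSeries.X ^ 2)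
      - 3 * (1 - PowerSeries.X) * discSeries) * hF +
      (1 - PowerSeries.X) ^ 2 * discSeries_sq
  have h := congrArg (psEval z) hq
  have s1 := (absSummable_C 2).mul hX
  have s2 := hFs.mul hFs
  have s3 := (absSummable_C (-2)).mul hX
  have s4 := (absSummable_C 3).mul (hX.mul hX)
  rw [psEval_mul hz s1 (s2.add (absSummable_C 1)), psEval_add hz s2 (absSummable_C 1),
    psEval_mul hz hFs hFs, psEval_mul hz (((absSummable_C 3).add s3).add s4) hFs,
    psEval_add hz ((absSummable_C 3).add s3) s4, psEval_add hz (absSummable_C 3) s3,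
    psEval_mul hz (absSummable_C 2) hX, psEval_mul hz (absSummable_C (-2)) hX,
    psEval_mul hz (absSummable_C 3) (hX.mul hX), psEval_mul hz hX hX] at h
  simp only [psEval_C, psEval_X] at h
  linear_combination h

lemma norm_psEval_passage_ne_one {F : PowerSeries ℂ}
    (hF : 4 * PowerSeries.X * F = 3 - 2 * PowerSeries.X + 3 * PowerSeries.X ^ 2
      - 3 * (1 - PowerSeries.X) * discSeries)
    {z : ℂ} (hz : ‖z‖ < 1) : ‖psEval z F‖ ≠ 1 := by
  intro h1
  have hq := psEval_passage_quadratic hF hz.le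
  set f := psEval z F
  have hff : f * (starRingEnd ℂ) f = 1 := by
    rw [Complex.mul_conj, Complex.normSq_eq_norm_sq, h1]; norm_num
  have hf0 : f ≠ 0 := by
    rintro h; rw [h, norm_zero] at h1; norm_num at h1
  have hz2 : 2 * z * (f + (starRingEnd ℂ) f) = 3 - 2 * z + 3 * z ^ 2 := by
    apply mul_right_cancel₀ hf0
    linear_combination hq + 2 * z * hff
  rw [Complex.add_conj] at hz2
  have hre : |f.re| ≤ 1 := h1 ▸ Complex.abs_re_le_norm f
  rw [abs_le] at hre
  have hn : z.re ^ 2 + z.im ^ 2 < 1 := by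
    have := Complex.sq_norm z
    rw [Complex.normSq_apply] at this
    nlinarith [norm_nonneg z]
  have e1 := congrArg Complex.re hz2
  have e2 := congrArg Complex.im hz2
  simp [pow_two] at e1 e2
  set p := z.re
  set q := z.im
  set u := f.re
  have e2' : q * (3 * p - (1 + 2 * u)) = 0 := by linear_combination -e2 / 2
  rcases mul_eq_zero.1 e2' with hq0 | hp
  · rw [hq0] at e1 hn
    nlinarith [sq_nonneg (p - 1), sq_nonneg (p + 1)]
  · have : 3 * p = 1 + 2 * u := by linarith
    nlinarith

lemma norm_psEval_passage_le_one {F : PowerSeries ℂ}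
    (hF : 4 * PowerSeries.X * F = 3 - 2 * PowerSeries.X + 3 * PowerSeries.X ^ 2
      - 3 * (1 - PowerSeries.X) * discSeries)
    {z : ℂ} (hz : ‖z‖ ≤ 1) : ‖psEval z F‖ ≤ 1 := by
  by_contra! hgt
  have hseg (r : ℝ) (hr : r ∈ Set.Icc (0 : ℝ) 1) : ‖(r : ℂ) * z‖ ≤ r := by
    rw [norm_mul, Complex.norm_real, Real.norm_of_nonneg hr.1]
    exact mul_le_of_le_one_right hr.1 hz
  have hcont : ContinuousOn (fun r : ℝ => ‖psEval ((r : ℂ) * z) F‖) (Set.Icc 0 1) := by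
    refine ((continuousOn_psEval (absSummable_passage hF)).comp
      (f := fun r : ℝ => (r : ℂ) * z) (by fun_prop) fun r hr => ?_).norm
    exact mem_closedBall_zero_iff.2 ((hseg r hr).trans hr.2)
  have h0 : psEval (0 : ℂ) F = 0 := by
    have := psEval_passage_quadratic hF (z := 0) (by simp)
    simpa using this
  obtain ⟨r, hr, hr1⟩ := intermediate_value_Icc zero_le_one hcont
    (show (1 : ℝ) ∈ _ by
      simp only [Complex.ofReal_zero, zero_mul, Complex.ofReal_one, one_mul, h0, norm_zero]
      exact ⟨zero_le_one, hgt.le⟩)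
  rcases hr.2.lt_or_eq with hlt | rfl
  · exact norm_psEval_passage_ne_one hF ((hseg r hr).trans_lt hlt) hr1
  · simp only [Complex.ofReal_one, one_mul] at hr1
    exact hgt.ne' hr1

open Complex in
lemma psEval_passage_circle {F : PowerSeries ℂ}
    (hF : 4 * PowerSeries.X * F = 3 - 2 * PowerSeries.X + 3 * PowerSeries.X ^ 2
      - 3 * (1 - PowerSeries.X) * discSeries)
    (θ : ℝ) :
    psEval (exp (θ * I)) F ^ 2 + 1 = ((3 * Real.cos θ - 1 : ℝ) : ℂ) * psEval (exp (θ * I)) F := by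
  have hn : ‖exp (θ * I)‖ = 1 := norm_exp_ofReal_mul_I θ
  have hq := psEval_passage_quadratic hF hn.le
  have h0 : exp (θ * I) ≠ 0 := exp_ne_zero _
  have hc : 2 * exp (θ * I) * (Real.cos θ : ℂ) = exp (θ * I) ^ 2 + 1 := by
    rw [ofReal_cos, cos, neg_mul, exp_neg]
    field_simp
  push_cast at hc ⊢
  apply mul_left_cancel₀ (mul_ne_zero two_ne_zero h0)
  linear_combination hq - 3 * psEval (exp (θ * I)) F * hc

open Complex in
lemma normSq_psEval_passage_of_ge {F : PowerSeries ℂ}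
    (hF : 4 * PowerSeries.X * F = 3 - 2 * PowerSeries.X + 3 * PowerSeries.X ^ 2
      - 3 * (1 - PowerSeries.X) * discSeries)
    {θ : ℝ} (hθ : -1 / 3 ≤ Real.cos θ) :
    ‖psEval (exp (θ * I)) F‖ ^ 2 = 1 := by
  have hq := psEval_passage_circle hF θ
  set f := psEval (exp (θ * I)) F
  have h1 := Real.cos_le_one θ
  set b : ℝ := 3 * Real.cos θ - 1 with hb
  have e1 := congrArg Complex.re hq
  have e2 := congrArg Complex.im hq
  simp [pow_two] at e1 e2
  rw [Complex.sq_norm, Complex.normSq_apply]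
  have e2' : f.im * (2 * f.re - b) = 0 := by linear_combination e2
  rcases mul_eq_zero.1 e2' with h | h
  · rw [h] at e1 ⊢
    have hsq : (f.re - b / 2) ^ 2 = b ^ 2 / 4 - 1 := by linear_combination e1
    have hb2 : b ^ 2 ≤ 4 := by nlinarith
    have h3 : (f.re - b / 2) ^ 2 = 0 := le_antisymm (by linarith) (sq_nonneg _)
    have h4 := pow_eq_zero_iff two_ne_zero |>.1 h3
    nlinarith
  · have : b = 2 * f.re := by linarith
    rw [this] at e1
    linarith

open Complex in
lemma normSq_psEval_passage_of_le {F : PowerSeries ℂ}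
    (hF : 4 * PowerSeries.X * F = 3 - 2 * PowerSeries.X + 3 * PowerSeries.X ^ 2
      - 3 * (1 - PowerSeries.X) * discSeries)
    {θ : ℝ} (hθ : Real.cos θ ≤ -1 / 3) :
    ‖psEval (exp (θ * I)) F‖ ^ 2 =
      ((3 * Real.cos θ - 1 + √((3 * Real.cos θ - 1) ^ 2 - 4)) / 2) ^ 2 := by
  have hq := psEval_passage_circle hF θ
  have hle := norm_psEval_passage_le_one hF (norm_exp_ofReal_mul_I θ).le
  set f := psEval (exp (θ * I)) F
  set b : ℝ := 3 * Real.cos θ - 1 with hb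
  have hb2 : b ≤ -2 := by linarith
  have hre := (abs_le.1 ((Complex.abs_re_le_norm f).trans hle)).1
  have e1 := congrArg Complex.re hq
  have e2 := congrArg Complex.im hq
  simp [pow_two] at e1 e2
  rw [Complex.sq_norm, Complex.normSq_apply]
  have e2' : f.im * (2 * f.re - b) = 0 := by linear_combination e2
  have him : f.im = 0 := by
    rcases mul_eq_zero.1 e2' with h | h
    · exact h
    · have : b = 2 * f.re := by linarith
      rw [this] at e1
      have : f.im * f.im ≤ 0 := by nlinarith
      exact mul_self_eq_zero.1 (le_antisymm this (mul_self_nonneg _))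
  rw [him] at e1 ⊢
  have hroot : √(b ^ 2 - 4) = 2 * f.re - b := by
    rw [show b ^ 2 - 4 = (2 * f.re - b) ^ 2 by linear_combination -4 * e1]
    exact Real.sqrt_sq (by linarith)
  rw [hroot]
  ring


/-- An antiderivative of `(4v² - 8)√(1 - v²)`. -/
noncomputable def arcPrimitive (v : ℝ) : ℝ :=
  -7 / 2 * Real.arcsin v - 9 / 2 * (v * √(1 - v ^ 2)) + v ^ 3 * √(1 - v ^ 2)

lemma hasDerivAt_arcPrimitive {v : ℝ} (h1 : -1 < v) (h2 : v < 1) :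
    HasDerivAt arcPrimitive ((4 * v ^ 2 - 8) * √(1 - v ^ 2)) v := by
  have hpos : 0 < 1 - v ^ 2 := by nlinarith
  have hq : 0 < √(1 - v ^ 2) := Real.sqrt_pos.2 hpos
  have hq2 : √(1 - v ^ 2) ^ 2 = 1 - v ^ 2 := Real.sq_sqrt hpos.le
  have hs : HasDerivAt (fun v : ℝ => √(1 - v ^ 2)) (-v / √(1 - v ^ 2)) v := by
    refine (((hasDerivAt_pow 2 v).const_sub 1).sqrt hpos.ne').congr_deriv ?_
    norm_num
    field_simp
  have ha := Real.hasDerivAt_arcsin h1.ne' h2.ne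
  refine (((ha.const_mul (-7 / 2)).sub (((hasDerivAt_id v).mul hs).const_mul (9 / 2))).add
    ((hasDerivAt_pow 3 v).mul hs)).congr_deriv ?_
  simp only [id]
  norm_num
  field_simp
  linear_combination (7 - 2 * v ^ 2) * hq2

lemma integral_passage_arc :
    ∫ θ in Real.arccos (-1 / 3)..Real.pi,
      ((3 * Real.cos θ - 1 + √((3 * Real.cos θ - 1) ^ 2 - 4)) / 2) ^ 2 =
    5 * √2 / 2 - 7 / 4 * Real.arccos (-1 / 3) := by
  set θ₀ := Real.arccos (-1 / 3) with hθ₀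
  have hcos0 : Real.cos θ₀ = -1 / 3 := Real.cos_arccos (by norm_num) (by norm_num)
  have h00 : 0 ≤ θ₀ := Real.arccos_nonneg _
  have h0π : θ₀ ≤ Real.pi := Real.arccos_le_pi _
  have h3 : √3 ^ 2 = 3 := Real.sq_sqrt (by norm_num)
  have hsin0 : Real.sin θ₀ = 2 * √2 / 3 := by
    rw [hθ₀, Real.sin_arccos, Real.sqrt_eq_iff_mul_self_eq (by norm_num) (by positivity)]
    nlinarith [Real.sq_sqrt (show (0 : ℝ) ≤ 2 by norm_num)]
  have hhalf (θ : ℝ) : Real.cos θ = 2 * Real.cos (θ / 2) ^ 2 - 1 := by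
    rw [← Real.cos_two_mul]; ring_nf
  have hv0 : √3 * Real.cos (θ₀ / 2) = 1 := by
    have hc : 0 ≤ Real.cos (θ₀ / 2) :=
      Real.cos_nonneg_of_neg_pi_div_two_le_of_le (by linarith) (by linarith)
    have h1 : (√3 * Real.cos (θ₀ / 2)) ^ 2 = 1 := by
      have := hhalf θ₀
      rw [mul_pow, h3]; linarith
    nlinarith [mul_nonneg (Real.sqrt_nonneg 3) hc]
  rw [intervalIntegral.integral_eq_sub_of_hasDerivAt_of_le (f := fun θ => 7 / 4 * θ
      + 9 / 4 * (Real.sin θ * Real.cos θ) - 3 * Real.sin θ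
      - arcPrimitive (√3 * Real.cos (θ / 2))) h0π]
  · rw [hv0, hcos0, hsin0]
    simp [arcPrimitive]
    ring
  · refine Continuous.continuousOn ?_
    unfold arcPrimitive
    have := Real.continuous_arcsin
    fun_prop
  · intro θ hθ
    have hS : 0 ≤ Real.sin (θ / 2) :=
      Real.sin_nonneg_of_nonneg_of_le_pi (by linarith [hθ.1]) (by linarith [hθ.2, Real.pi_pos])
    have hC : 0 < Real.cos (θ / 2) :=
      Real.cos_pos_of_mem_Ioo ⟨by linarith [hθ.1, Real.pi_pos], by linarith [hθ.2]⟩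
    have hlt : Real.cos (θ / 2) < Real.cos (θ₀ / 2) :=
      Real.cos_lt_cos_of_nonneg_of_le_pi (by linarith) (by linarith [hθ.2, Real.pi_pos])
        (by linarith [hθ.1])
    have h3p : 0 < √3 := Real.sqrt_pos.2 (by norm_num)
    have hv1 : √3 * Real.cos (θ / 2) < 1 := hv0 ▸ mul_lt_mul_of_pos_left hlt h3p
    have hv2 : 0 < √3 * Real.cos (θ / 2) := mul_pos h3p hC
    have hsc := Real.sin_sq_add_cos_sq (θ / 2)
    have hsc' := Real.sin_sq_add_cos_sq θ
    have hq2 : √(1 - (√3 * Real.cos (θ / 2)) ^ 2) ^ 2 = 1 - (√3 * Real.cos (θ / 2)) ^ 2 :=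
      Real.sq_sqrt (by nlinarith)
    have hY : (2 * √3 * Real.sin (θ / 2) * √(1 - (√3 * Real.cos (θ / 2)) ^ 2)) ^ 2 =
        (3 * Real.cos θ - 1) ^ 2 - 4 := by
      rw [mul_pow, mul_pow, mul_pow, hq2, mul_pow, h3, hhalf θ,
        show Real.sin (θ / 2) ^ 2 = 1 - Real.cos (θ / 2) ^ 2 by linarith]
      ring
    have hr : √((3 * Real.cos θ - 1) ^ 2 - 4) =
        2 * √3 * Real.sin (θ / 2) * √(1 - (√3 * Real.cos (θ / 2)) ^ 2) := by
      rw [← hY]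
      exact Real.sqrt_sq (by positivity)
    have hv : HasDerivAt (fun θ : ℝ => √3 * Real.cos (θ / 2))
        (√3 * (-Real.sin (θ / 2) * (1 / 2))) θ :=
      (((hasDerivAt_id θ).div_const 2).cos).const_mul _
    have hK := (hasDerivAt_arcPrimitive (by linarith) hv1).comp θ hv
    refine (((((hasDerivAt_id θ).const_mul (7 / 4)).add
      (((Real.hasDerivAt_sin θ).mul (Real.hasDerivAt_cos θ)).const_mul (9 / 4))).sub
      ((Real.hasDerivAt_sin θ).const_mul 3)).sub hK).congr_deriv ?_
    rw [hr]
    set q := √(1 - (√3 * Real.cos (θ / 2)) ^ 2)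
    linear_combination (-9 / 4) * hsc' - 1 / 4 * hY + √3 * Real.sin (θ / 2) * q *
      (2 * Real.cos (θ / 2) ^ 2 * h3 - 3 * hhalf θ)
  · refine Continuous.intervalIntegrable ?_ _ _
    fun_prop

open Complex in
lemma integral_normSq_passage {F : PowerSeries ℂ}
    (hF : 4 * PowerSeries.X * F = 3 - 2 * PowerSeries.X + 3 * PowerSeries.X ^ 2
      - 3 * (1 - PowerSeries.X) * discSeries) :
    ∫ θ in (0 : ℝ)..2 * Real.pi, ‖psEval (exp (θ * I)) F‖ ^ 2 =
      5 * √2 - 3 / 2 * Real.arccos (-1 / 3) := by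
  set f : ℝ → ℝ := fun θ => ‖psEval (exp (θ * I)) F‖ ^ 2 with hf
  have hcont : Continuous f :=
    ((continuousOn_psEval (absSummable_passage hF)).comp_continuous
      (f := fun θ : ℝ => exp (θ * I)) (by fun_prop)
      fun θ => by simp [norm_exp_ofReal_mul_I θ]).norm.pow 2
  have hint (a b : ℝ) : IntervalIntegrable f MeasureTheory.volume a b :=
    hcont.intervalIntegrable a b
  have hcos0 : Real.cos (Real.arccos (-1 / 3)) = -1 / 3 :=
    Real.cos_arccos (by norm_num) (by norm_num)
  have h00 : 0 ≤ Real.arccos (-1 / 3) := Real.arccos_nonneg _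
  have h0π : Real.arccos (-1 / 3) ≤ Real.pi := Real.arccos_le_pi _
  have hsymm (θ : ℝ) : f (2 * Real.pi - θ) = f θ := by
    have hc : Real.cos (2 * Real.pi - θ) = Real.cos θ := Real.cos_two_pi_sub θ
    rcases le_total (-1 / 3) (Real.cos θ) with h | h
    · simp only [hf]
      rw [normSq_psEval_passage_of_ge hF h, normSq_psEval_passage_of_ge hF (hc ▸ h)]
    · simp only [hf]
      rw [normSq_psEval_passage_of_le hF h, normSq_psEval_passage_of_le hF (hc ▸ h), hc]
  have hhalf : ∫ θ in Real.pi..2 * Real.pi, f θ = ∫ θ in (0 : ℝ)..Real.pi, f θ := by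
    have := intervalIntegral.integral_comp_sub_left f (2 * Real.pi) (a := 0) (b := Real.pi)
    simp only [hsymm] at this
    rw [this]
    congr 1 <;> ring
  have hfirst : ∫ θ in (0 : ℝ)..Real.arccos (-1 / 3), f θ = Real.arccos (-1 / 3) := by
    rw [intervalIntegral.integral_congr (g := fun _ => (1 : ℝ))]
    · simp
    · intro θ hθ
      rw [Set.uIcc_of_le h00] at hθ
      refine normSq_psEval_passage_of_ge hF ?_
      rw [← hcos0]
      exact Real.cos_le_cos_of_nonneg_of_le_pi hθ.1 h0π hθ.2
  have hsecond : ∫ θ in Real.arccos (-1 / 3)..Real.pi, f θ =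
      5 * √2 / 2 - 7 / 4 * Real.arccos (-1 / 3) := by
    rw [← integral_passage_arc]
    refine intervalIntegral.integral_congr fun θ hθ => ?_
    rw [Set.uIcc_of_le h0π] at hθ
    refine normSq_psEval_passage_of_le hF ?_
    rw [← hcos0]
    exact Real.cos_le_cos_of_nonneg_of_le_pi h00 hθ.2 hθ.1
  rw [← intervalIntegral.integral_add_adjacent_intervals (hint 0 Real.pi) (hint _ _), hhalf,
    ← intervalIntegral.integral_add_adjacent_intervals (hint 0 (Real.arccos (-1 / 3))) (hint _ _),
    hfirst, hsecond]
  ring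

theorem semiInfinite_absorption_grover :
    GPinf 1 = 5 * Real.sqrt 2 / (2 * Real.pi) -
      3 * Real.arcsin (1 / 3) / (4 * Real.pi) - 3 / 8 := by
  obtain ⟨F, Y, W, hD, hF, hY, hW⟩ := exists_passageSeries
  have hc (t : ℕ) : gcInf 1 t ^ 2 = ‖PowerSeries.coeff t F‖ ^ 2 := by
    have := passageAmp_eq_coeff hF hY hW t 0 0
    simp only [Nat.cast_zero, zero_add, pow_zero, mul_one, Matrix.cons_val_zero] at this
    rw [gcInf_eq_passageAmp, Nat.cast_one, ← this, Complex.norm_real, Real.norm_eq_abs, sq_abs]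
  have harc : Real.arccos (-1 / 3) = Real.pi / 2 + Real.arcsin (1 / 3) := by
    rw [Real.arccos, neg_div, Real.arcsin_neg]; ring
  rw [GPinf, tsum_congr hc, tsum_normSq_coeff (absSummable_passage hD),
    integral_normSq_passage hD, harc]
  field_simp
  ring
end
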